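/- Let θ_g = (1+√5)/2, let a, b > 0 with a/b = θ_g, and for j ∈ ℕ, j ≥ 1, set A_j := (2π/(√5·a))·(θ_g^{2j} − θ_g^{−2j})·tan((π/2)θ_g^{−2j}). Then for every N ∈ ℕ, N ≥ 1, and every α < 0, the gap set G₋(α) has exactly N connected components (i.e., there are exactly N gaps in the positive spectrum) if and only if −A_{N+1} ≤ α < −A_N. -/

import Mathlib

open Real

/-- The gap condition set for a rectangular-lattice quantum graph with edge lengths
`a, b` and coupling `α > 0`. -/
def gapSetPlus (a b α : ℝ) : Set ℝ :=
  {k : ℝ | 0 < k ∧ (∀ n : ℤ, k * a / π ≠ n) ∧ (∀ n : ℤ, k * b / π ≠ n) ∧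
    2 * k * (Real.tan (k * a / 2 - π / 2 * ⌊k * a / π⌋)
      + Real.tan (k * b / 2 - π / 2 * ⌊k * b / π⌋)) < α}

/-- The gap condition set for a rectangular-lattice quantum graph with edge lengths
`a, b` and coupling `α < 0`. -/
def gapSetMinus (a b α : ℝ) : Set ℝ :=
  {k : ℝ | 0 < k ∧ (∀ n : ℤ, k * a / π ≠ n) ∧ (∀ n : ℤ, k * b / π ≠ n) ∧
    2 * k * (Real.cot (k * a / 2 - π / 2 * ⌊k * a / π⌋)
      + Real.cot (k * b / 2 - π / 2 * ⌊k * b / π⌋)) < |α|}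

/-- The collection of connected components of a set `G ⊆ ℝ`; open spectral gaps
correspond to its elements. -/
def gapComponents (G : Set ℝ) : Set (Set ℝ) :=
  {C : Set ℝ | ∃ k ∈ G, C = connectedComponentIn G k}

/-- The threshold coupling strengths `A_j` for the golden-mean rectangular lattice. -/
noncomputable def goldenThreshold (a : ℝ) (j : ℕ) : ℝ :=
  2 * π / (Real.sqrt 5 * a) *
    (((1 + Real.sqrt 5) / 2) ^ (2 * (j : ℤ)) - ((1 + Real.sqrt 5) / 2) ^ (-(2 * (j : ℤ)))) *
    Real.tan (π / 2 * ((1 + Real.sqrt 5) / 2) ^ (-(2 * (j : ℤ))))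

theorem strictAntiOn_add_mul_cot {d : ℝ} (hd : 0 ≤ d) :
    StrictAntiOn (fun u : ℝ => (u + d) * Real.cot u) (Set.Ioc 0 (π / 2)) := by
  have hsin : ∀ u ∈ Set.Ioc 0 (π / 2), 0 < Real.sin u := fun u hu =>
    Real.sin_pos_of_pos_of_lt_pi hu.1 (by linarith [hu.2, Real.pi_pos])
  have hderiv : ∀ u ∈ Set.Ioc 0 (π / 2), HasDerivAt (fun u : ℝ => (u + d) * Real.cot u)
      (1 * (Real.cos u / Real.sin u) + (u + d) *
        ((-Real.sin u * Real.sin u - Real.cos u * Real.cos u) / Real.sin u ^ 2)) u := by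
    intro u hu
    simp only [Real.cot_eq_cos_div_sin]
    exact ((hasDerivAt_id u).add_const d).mul
      ((Real.hasDerivAt_cos u).div (Real.hasDerivAt_sin u) (hsin u hu).ne')
  refine strictAntiOn_of_deriv_neg (convex_Ioc 0 (π / 2))
    (fun u hu => (hderiv u hu).continuousAt.continuousWithinAt) fun u hu => ?_
  have hu' := interior_subset hu
  rw [(hderiv u hu').deriv]
  have hs := hsin u hu'
  have hval : 1 * (Real.cos u / Real.sin u) + (u + d) *
      ((-Real.sin u * Real.sin u - Real.cos u * Real.cos u) / Real.sin u ^ 2)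
      = (Real.sin u * Real.cos u - (u + d)) / Real.sin u ^ 2 := by
    field_simp
    linear_combination -(u + d) * Real.sin_sq_add_cos_sq u
  rw [hval]
  refine div_neg_of_neg_of_pos ?_ (by positivity)
  nlinarith [Real.sin_lt hu'.1, Real.cos_le_one u]

/-- The function in the gap condition, with the integer parts of `k a / π` and `k b / π`
replaced by the integers `m` and `n`. -/
noncomputable def cellFun (a b : ℝ) (m n : ℤ) (k : ℝ) : ℝ :=
  2 * k * (Real.cot (k * a / 2 - π / 2 * m) + Real.cot (k * b / 2 - π / 2 * n))

/-- The left limit at `p` of the function in the gap condition. -/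
noncomputable def leftLevel (a b p : ℝ) : ℝ :=
  cellFun a b (⌈p * a / π⌉ - 1) (⌈p * b / π⌉ - 1) p

/-- The singular points of the gap condition at which the left limit is below `|α|`. -/
def gapEndpoints (a b α : ℝ) : Set ℝ :=
  {p : ℝ | 0 < p ∧ ((∃ n : ℤ, p * a / π = n) ∨ ∃ n : ℤ, p * b / π = n) ∧ leftLevel a b p < |α|}

/-- The smallest singular point of the gap condition lying to the right of `k`. -/
noncomputable def nextSingular (a b k : ℝ) : ℝ :=
  min ((⌊k * a / π⌋ + 1) * π / a) ((⌊k * b / π⌋ + 1) * π / b)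

theorem strictAntiOn_mul_cot {c : ℝ} (hc : 0 < c) {m : ℤ} (hm : 0 ≤ m) :
    StrictAntiOn (fun k : ℝ => k * Real.cot (k * c / 2 - π / 2 * m))
      {k | m < k * c / π ∧ k * c / π ≤ m + 1} := by
  intro x hx y hy hxy
  have hpi := Real.pi_pos
  have key : ∀ k : ℝ, (m < k * c / π ∧ k * c / π ≤ m + 1) →
      k * c / 2 - π / 2 * m ∈ Set.Ioc 0 (π / 2) := by
    rintro k ⟨h1, h2⟩
    rw [lt_div_iff₀ hpi] at h1
    rw [div_le_iff₀ hpi] at h2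
    constructor <;> linarith
  have hd : (0 : ℝ) ≤ π / 2 * m := by
    have : (0 : ℝ) ≤ m := by exact_mod_cast hm
    positivity
  have h := strictAntiOn_add_mul_cot hd (key x hx) (key y hy) (by nlinarith)
  simp only [sub_add_cancel] at h ⊢
  have e : ∀ k C : ℝ, k * c / 2 * C = (c / 2) * (k * C) := fun k C => by ring
  rw [e, e] at h
  exact lt_of_mul_lt_mul_left h (by positivity)

theorem strictAntiOn_cellFun {a b : ℝ} (ha : 0 < a) (hb : 0 < b) {m n : ℤ}
    (hm : 0 ≤ m) (hn : 0 ≤ n) :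
    StrictAntiOn (cellFun a b m n) ({k | m < k * a / π ∧ k * a / π ≤ m + 1} ∩
      {k | n < k * b / π ∧ k * b / π ≤ n + 1}) := by
  intro x hx y hy hxy
  have h1 := strictAntiOn_mul_cot ha hm hx.1 hy.1 hxy
  have h2 := strictAntiOn_mul_cot hb hn hx.2 hy.2 hxy
  simp only [cellFun] at h1 h2 ⊢
  linarith

theorem continuousAt_cellFun {a b : ℝ} {m n : ℤ} {p : ℝ}
    (hpa : m < p * a / π ∧ p * a / π ≤ m + 1) (hpb : n < p * b / π ∧ p * b / π ≤ n + 1) :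
    ContinuousAt (cellFun a b m n) p := by
  have hpi := Real.pi_pos
  have key : ∀ (c : ℝ) (l : ℤ), (l < p * c / π ∧ p * c / π ≤ l + 1) →
      Real.sin (p * c / 2 - π / 2 * l) ≠ 0 := by
    rintro c l ⟨h1, h2⟩
    rw [lt_div_iff₀ hpi] at h1
    rw [div_le_iff₀ hpi] at h2
    exact (Real.sin_pos_of_pos_of_lt_pi (by linarith) (by linarith)).ne'
  have h1 := key a m hpa
  have h2 := key b n hpb
  unfold cellFun
  simp only [Real.cot_eq_cos_div_sin]
  fun_prop (disch := assumption)

theorem nextSingular_eq {a b k k' : ℝ} (h1 : ⌊k * a / π⌋ = ⌊k' * a / π⌋)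
    (h2 : ⌊k * b / π⌋ = ⌊k' * b / π⌋) : nextSingular a b k = nextSingular a b k' := by
  simp only [nextSingular, h1, h2]

theorem lt_nextSingular {a b : ℝ} (ha : 0 < a) (hb : 0 < b) (k : ℝ) :
    k < nextSingular a b k := by
  have hpi := Real.pi_pos
  have key : ∀ c : ℝ, 0 < c → k < (⌊k * c / π⌋ + 1) * π / c := fun c hc => by
    rw [lt_div_iff₀ hc, ← div_lt_iff₀ hpi]
    exact Int.lt_floor_add_one _
  exact lt_min (key a ha) (key b hb)

theorem nextSingular_mul_le_left {a b : ℝ} (ha : 0 < a) (k : ℝ) :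
    nextSingular a b k * a / π ≤ ⌊k * a / π⌋ + 1 := by
  rw [div_le_iff₀ Real.pi_pos, ← le_div_iff₀ ha]
  exact min_le_left _ _

theorem nextSingular_mul_le_right {a b : ℝ} (hb : 0 < b) (k : ℝ) :
    nextSingular a b k * b / π ≤ ⌊k * b / π⌋ + 1 := by
  rw [div_le_iff₀ Real.pi_pos, ← le_div_iff₀ hb]
  exact min_le_right _ _

theorem nextSingular_isSingular {a b : ℝ} (ha : 0 < a) (hb : 0 < b) (k : ℝ) :
    (∃ n : ℤ, nextSingular a b k * a / π = n) ∨ ∃ n : ℤ, nextSingular a b k * b / π = n := by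
  have hpi := Real.pi_pos
  rcases min_choice ((⌊k * a / π⌋ + 1) * π / a) ((⌊k * b / π⌋ + 1) * π / b) with h | h
  · refine Or.inl ⟨⌊k * a / π⌋ + 1, ?_⟩
    rw [nextSingular, h]
    push_cast
    field_simp
  · refine Or.inr ⟨⌊k * b / π⌋ + 1, ?_⟩
    rw [nextSingular, h]
    push_cast
    field_simp

theorem floor_lt_of_not_int {x : ℝ} (hx : ∀ n : ℤ, x ≠ n) : (⌊x⌋ : ℝ) < x :=
  lt_of_le_of_ne (Int.floor_le x) (hx _).symm

theorem mem_gapSetMinus_of_floor_eq {a b α k : ℝ} {m n : ℤ} (hk : 0 < k)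
    (hma : m < k * a / π ∧ k * a / π < m + 1) (hnb : n < k * b / π ∧ k * b / π < n + 1)
    (h : cellFun a b m n k < |α|) :
    k ∈ gapSetMinus a b α ∧ ⌊k * a / π⌋ = m ∧ ⌊k * b / π⌋ = n := by
  have key : ∀ (x : ℝ) (l : ℤ), (l < x ∧ x < l + 1) → ∀ j : ℤ, x ≠ j := by
    rintro x l ⟨h1, h2⟩ j rfl
    have h1 : l < j := by exact_mod_cast h1
    have h2 : j < l + 1 := by exact_mod_cast h2
    omega
  have e1 : ⌊k * a / π⌋ = m := Int.floor_eq_iff.2 ⟨hma.1.le, hma.2⟩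
  have e2 : ⌊k * b / π⌋ = n := Int.floor_eq_iff.2 ⟨hnb.1.le, hnb.2⟩
  refine ⟨⟨hk, key _ _ hma, key _ _ hnb, ?_⟩, e1, e2⟩
  rw [e1, e2]
  exact h

theorem Ico_nextSingular_subset {a b α k y : ℝ} (ha : 0 < a) (hb : 0 < b)
    (hk : k ∈ gapSetMinus a b α) (hky : k ≤ y) (hy : y < nextSingular a b k) :
    y ∈ gapSetMinus a b α ∧ nextSingular a b y = nextSingular a b k := by
  have hpi := Real.pi_pos
  obtain ⟨hk0, hka, hkb, hlt⟩ := hk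
  have ha1 := floor_lt_of_not_int hka
  have hb1 := floor_lt_of_not_int hkb
  have hya : (⌊k * a / π⌋ : ℝ) < y * a / π := ha1.trans_le (by gcongr)
  have hyb : (⌊k * b / π⌋ : ℝ) < y * b / π := hb1.trans_le (by gcongr)
  have hya' : y * a / π < ⌊k * a / π⌋ + 1 :=
    lt_of_lt_of_le (by gcongr) (nextSingular_mul_le_left (b := b) ha k)
  have hyb' : y * b / π < ⌊k * b / π⌋ + 1 :=
    lt_of_lt_of_le (by gcongr) (nextSingular_mul_le_right (a := a) hb k)
  have hanti := (strictAntiOn_cellFun ha hb (m := ⌊k * a / π⌋) (n := ⌊k * b / π⌋)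
    (Int.floor_nonneg.2 (by positivity)) (Int.floor_nonneg.2 (by positivity))).antitoneOn
    ⟨⟨ha1, (Int.lt_floor_add_one _).le⟩, ⟨hb1, (Int.lt_floor_add_one _).le⟩⟩
    ⟨⟨hya, hya'.le⟩, ⟨hyb, hyb'.le⟩⟩ hky
  obtain ⟨h1, h2, h3⟩ := mem_gapSetMinus_of_floor_eq (hk0.trans_le hky) ⟨hya, hya'⟩
    ⟨hyb, hyb'⟩ (hanti.trans_lt hlt)
  exact ⟨h1, nextSingular_eq h2 h3⟩

theorem nextSingular_mem_gapEndpoints {a b α k : ℝ} (ha : 0 < a) (hb : 0 < b)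
    (hk : k ∈ gapSetMinus a b α) : nextSingular a b k ∈ gapEndpoints a b α := by
  have hpi := Real.pi_pos
  obtain ⟨hk0, hka, hkb, hlt⟩ := hk
  have hkp := lt_nextSingular ha hb k
  have ha1 := floor_lt_of_not_int hka
  have hb1 := floor_lt_of_not_int hkb
  have hpa : (⌊k * a / π⌋ : ℝ) < nextSingular a b k * a / π := ha1.trans_le (by gcongr)
  have hpb : (⌊k * b / π⌋ : ℝ) < nextSingular a b k * b / π := hb1.trans_le (by gcongr)
  have hpa' := nextSingular_mul_le_left (b := b) ha k
  have hpb' := nextSingular_mul_le_right (a := a) hb k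
  have e1 : ⌈nextSingular a b k * a / π⌉ = ⌊k * a / π⌋ + 1 :=
    Int.ceil_eq_iff.2 ⟨by push_cast; linarith, by push_cast; linarith⟩
  have e2 : ⌈nextSingular a b k * b / π⌉ = ⌊k * b / π⌋ + 1 :=
    Int.ceil_eq_iff.2 ⟨by push_cast; linarith, by push_cast; linarith⟩
  refine ⟨hk0.trans hkp, nextSingular_isSingular ha hb k, ?_⟩
  rw [leftLevel, e1, e2, add_sub_cancel_right, add_sub_cancel_right]
  exact (strictAntiOn_cellFun ha hb (Int.floor_nonneg.2 (by positivity))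
    (Int.floor_nonneg.2 (by positivity))
    ⟨⟨ha1, (Int.lt_floor_add_one _).le⟩, ⟨hb1, (Int.lt_floor_add_one _).le⟩⟩
    ⟨⟨hpa, hpa'⟩, ⟨hpb, hpb'⟩⟩ hkp).trans hlt

theorem exists_nextSingular_eq {a b α p : ℝ} (ha : 0 < a) (hb : 0 < b)
    (hp : p ∈ gapEndpoints a b α) : ∃ k ∈ gapSetMinus a b α, nextSingular a b k = p := by
  have hpi := Real.pi_pos
  obtain ⟨hp0, hsing, hlt⟩ := hp
  have bound : ∀ x : ℝ, ((⌈x⌉ - 1 : ℤ) : ℝ) < x ∧ x ≤ ((⌈x⌉ - 1 : ℤ) : ℝ) + 1 := fun x => by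
    push_cast
    exact ⟨by linarith [Int.ceil_lt_add_one x], by linarith [Int.le_ceil x]⟩
  have hpa := bound (p * a / π)
  have hpb := bound (p * b / π)
  have hcont := continuousAt_cellFun hpa hpb
  have near : ∀ c : ℝ, ∀ᶠ k in nhdsWithin p (Set.Iio p), ((⌈p * c / π⌉ - 1 : ℤ) : ℝ) < k * c / π :=
    fun c => ((by fun_prop : ContinuousAt (fun k : ℝ => k * c / π) p).eventually_const_lt
      (bound (p * c / π)).1).filter_mono nhdsWithin_le_nhds
  have left : ∀ᶠ k in nhdsWithin p (Set.Iio p), k < p := self_mem_nhdsWithin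
  obtain ⟨k, hk, hka, hkb, hkp, hk0⟩ :=
    (((hcont.eventually_lt_const hlt).filter_mono nhdsWithin_le_nhds).and
      ((near a).and ((near b).and (left.and
        ((lt_mem_nhds hp0).filter_mono nhdsWithin_le_nhds))))).exists
  obtain ⟨h1, h2, h3⟩ := mem_gapSetMinus_of_floor_eq hk0
    ⟨hka, lt_of_lt_of_le (by gcongr) hpa.2⟩ ⟨hkb, lt_of_lt_of_le (by gcongr) hpb.2⟩ hk
  refine ⟨k, h1, ?_⟩
  have hle : ∀ c : ℝ, 0 < c → p ≤ (((⌈p * c / π⌉ - 1 : ℤ) : ℝ) + 1) * π / c := fun c hc => by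
    rw [le_div_iff₀ hc, ← div_le_iff₀ hpi]
    exact (bound _).2
  have heq : ∀ c : ℝ, 0 < c → (∃ n : ℤ, p * c / π = n) →
      (((⌈p * c / π⌉ - 1 : ℤ) : ℝ) + 1) * π / c = p := by
    rintro c hc ⟨n, hn⟩
    rw [hn, Int.ceil_intCast]
    push_cast
    rw [sub_add_cancel, ← hn]
    field_simp
  rw [nextSingular, h2, h3]
  refine le_antisymm ?_ (le_min (hle a ha) (hle b hb))
  rcases hsing with h | h
  · exact (min_le_left _ _).trans (heq a ha h).le
  · exact (min_le_right _ _).trans (heq b hb h).le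

theorem notMem_gapSetMinus_of_singular {a b α p : ℝ}
    (hp : (∃ n : ℤ, p * a / π = n) ∨ ∃ n : ℤ, p * b / π = n) : p ∉ gapSetMinus a b α := by
  rintro ⟨-, h1, h2, -⟩
  rcases hp with ⟨n, hn⟩ | ⟨n, hn⟩
  exacts [h1 n hn, h2 n hn]

theorem connectedComponentIn_gapSetMinus_eq_iff {a b α k k' : ℝ} (ha : 0 < a) (hb : 0 < b)
    (hk : k ∈ gapSetMinus a b α) (hk' : k' ∈ gapSetMinus a b α) :
    connectedComponentIn (gapSetMinus a b α) k = connectedComponentIn (gapSetMinus a b α) k' ↔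
      nextSingular a b k = nextSingular a b k' := by
  wlog hle : k ≤ k' generalizing k k'
  · rw [eq_comm, this hk' hk (le_of_not_ge hle), eq_comm]
  constructor
  · intro h
    have hsub : Set.Icc k k' ⊆ gapSetMinus a b α :=
      (isPreconnected_connectedComponentIn.ordConnected.out (h ▸ mem_connectedComponentIn hk)
        (mem_connectedComponentIn hk')).trans (connectedComponentIn_subset _ _)
    have hlt : k' < nextSingular a b k := by
      by_contra! hcon
      exact notMem_gapSetMinus_of_singular (nextSingular_isSingular ha hb k)
        (hsub ⟨(lt_nextSingular ha hb k).le, hcon⟩)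
    exact (Ico_nextSingular_subset ha hb hk hle hlt).2.symm
  · intro h
    have hsub : Set.Icc k k' ⊆ gapSetMinus a b α := fun y hy =>
      (Ico_nextSingular_subset ha hb hk hy.1 (hy.2.trans_lt (h ▸ lt_nextSingular ha hb k'))).1
    exact connectedComponentIn_eq (isPreconnected_Icc.subset_connectedComponentIn
      (Set.left_mem_Icc.2 hle) hsub (Set.right_mem_Icc.2 hle))

/-- The gaps are in bijection with their right endpoints. -/
theorem exists_bijOn_gapComponents {a b : ℝ} (ha : 0 < a) (hb : 0 < b) (α : ℝ) :
    ∃ f : ℝ → Set ℝ, Set.BijOn f (gapEndpoints a b α) (gapComponents (gapSetMinus a b α)) := by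
  choose! g hg using fun p (hp : p ∈ gapEndpoints a b α) => exists_nextSingular_eq ha hb hp
  refine ⟨fun p => connectedComponentIn (gapSetMinus a b α) (g p),
    fun p hp => ⟨g p, (hg p hp).1, rfl⟩, fun p hp q hq h => ?_, ?_⟩
  · have := (connectedComponentIn_gapSetMinus_eq_iff ha hb (hg p hp).1 (hg q hq).1).1 h
    rwa [(hg p hp).2, (hg q hq).2] at this
  · rintro C ⟨k, hk, rfl⟩
    have hp := nextSingular_mem_gapEndpoints ha hb hk
    exact ⟨nextSingular a b k, hp,
      (connectedComponentIn_gapSetMinus_eq_iff ha hb (hg _ hp).1 hk).2 (hg _ hp).2⟩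

theorem exists_fib_of_norm_eq_one {n q : ℕ} (hn : 0 < n) (h : q ^ 2 = q * n + n ^ 2 + 1) :
    ∃ j : ℕ, 1 ≤ j ∧ n = Nat.fib (2 * j) ∧ q = Nat.fib (2 * j + 1) := by
  induction n using Nat.strong_induction_on generalizing q with
  | _ n ih =>
    have h1 : n < q := by nlinarith
    have h2 : q ≤ 2 * n := by nlinarith
    obtain ⟨q', rfl⟩ := Nat.exists_eq_add_of_le h1.le
    obtain ⟨n', rfl⟩ := Nat.exists_eq_add_of_le (show q' ≤ n by omega)
    rcases Nat.eq_zero_or_pos n' with rfl | hn'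
    · have : q' = 1 := by nlinarith
      subst this
      exact ⟨1, le_rfl, by decide, by decide⟩
    · obtain ⟨j, hj, e1, e2⟩ := ih n' (by omega) hn' (q := q') (by nlinarith)
      have f1 : Nat.fib (2 * (j + 1)) = Nat.fib (2 * j) + Nat.fib (2 * j + 1) := Nat.fib_add_two
      have f2 : Nat.fib (2 * (j + 1) + 1) = Nat.fib (2 * j + 1) + Nat.fib (2 * (j + 1)) :=
        Nat.fib_add_two
      exact ⟨j + 1, by omega, by omega, by omega⟩

/-- The distance from `n φ` up to the next integer. -/
noncomputable def ceilGap (n : ℕ) : ℝ := ⌈(n : ℝ) * goldenRatio⌉ - n * goldenRatio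

theorem ceilGap_pos {n : ℕ} (hn : 0 < n) : 0 < ceilGap n := by
  refine sub_pos.2 (lt_of_le_of_ne (Int.le_ceil _) fun h => ?_)
  exact (goldenRatio_irrational.natCast_mul hn.ne').ne_int _ h

theorem ceilGap_lt_one (n : ℕ) : ceilGap n < 1 := by
  have := Int.ceil_lt_add_one ((n : ℝ) * goldenRatio)
  unfold ceilGap
  linarith

theorem ceilGap_mul (n : ℕ) : ceilGap n * (ceilGap n + n * √5) =
    ((⌈(n : ℝ) * goldenRatio⌉ ^ 2 - ⌈(n : ℝ) * goldenRatio⌉ * n - n ^ 2 : ℤ) : ℝ) := by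
  have h5 : √5 ^ 2 = 5 := Real.sq_sqrt (by norm_num)
  simp only [ceilGap, goldenRatio]
  push_cast
  linear_combination (-(n : ℝ) ^ 2 / 4) * h5

theorem two_lt_sqrt_five : 2 < √5 := by
  rw [Real.lt_sqrt] <;> norm_num

theorem sqrt_five_lt : √5 < 9 / 4 := by
  rw [Real.sqrt_lt] <;> norm_num

theorem ceilGap_norm_pos {n : ℕ} (hn : 0 < n) :
    1 ≤ ⌈(n : ℝ) * goldenRatio⌉ ^ 2 - ⌈(n : ℝ) * goldenRatio⌉ * n - (n : ℤ) ^ 2 := by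
  have h := ceilGap_mul n
  have h0 := ceilGap_pos hn
  have : 0 < ceilGap n * (ceilGap n + n * √5) := by positivity
  rw [h] at this
  exact_mod_cast this

theorem mul_le_tan_ceilGap {n : ℕ} (hn : 0 < n) :
    π / 2 * (n * ceilGap n) ≤ n * Real.tan (π / 2 * ceilGap n) := by
  have h0 := ceilGap_pos hn
  have h1 := ceilGap_lt_one n
  have hpi := Real.pi_pos
  have := Real.le_tan (x := π / 2 * ceilGap n) (by positivity) (by nlinarith)
  calc π / 2 * (n * ceilGap n) = n * (π / 2 * ceilGap n) := by ring
    _ ≤ _ := by gcongr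

theorem le_goldenRatio_mul_tan_ceilGap {n : ℕ} (hn : 0 < n) :
    π / (2 * √5) ≤ goldenRatio * (n * Real.tan (π / 2 * ceilGap n)) := by
  have h0 := ceilGap_pos hn
  have h5 := two_lt_sqrt_five
  have h5' := sqrt_five_lt
  have hφ := goldenRatio_pos
  have hn1 : (1 : ℝ) ≤ n := by exact_mod_cast hn
  have hM : (1 : ℝ) ≤ ceilGap n * (ceilGap n + n * √5) := by
    rw [ceilGap_mul]
    exact_mod_cast ceilGap_norm_pos hn
  have hδ := ceilGap_lt_one n
  have hkey : 1 ≤ goldenRatio * (n * ceilGap n) * √5 := by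
    by_cases hs : ceilGap n ≤ 3 / 5
    · have : (16 : ℝ) / 25 ≤ n * ceilGap n * √5 := by nlinarith
      have h2 : (8 : ℝ) / 5 ≤ goldenRatio := by
        have : (11 : ℝ) / 5 ≤ √5 := Real.le_sqrt_of_sq_le (by norm_num)
        simp only [goldenRatio]; linarith
      nlinarith
    · have h1 : 3 / 5 ≤ n * ceilGap n := by nlinarith
      have h2 : (3 : ℝ) / 2 ≤ goldenRatio := by simp only [goldenRatio]; linarith
      have : 9 / 10 ≤ goldenRatio * (n * ceilGap n) := by nlinarith
      nlinarith
  calc π / (2 * √5) = π / (2 * √5) * 1 := by ring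
    _ ≤ π / (2 * √5) * (goldenRatio * (n * ceilGap n) * √5) := by gcongr
    _ = goldenRatio * (π / 2 * (n * ceilGap n)) := by field_simp
    _ ≤ _ := mul_le_mul_of_nonneg_left (mul_le_tan_ceilGap hn) hφ.le

theorem le_tan_ceilGap_or_exists_fib {n : ℕ} (hn : 0 < n) :
    π / (2 * √5) ≤ n * Real.tan (π / 2 * ceilGap n) ∨ ∃ j : ℕ, 1 ≤ j ∧ n = Nat.fib (2 * j) := by
  have hM := ceilGap_norm_pos hn
  have hQ : 0 ≤ ⌈(n : ℝ) * goldenRatio⌉ := by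
    have := goldenRatio_pos
    exact Int.ceil_nonneg (by positivity)
  have hmul := ceilGap_mul n
  generalize ⌈(n : ℝ) * goldenRatio⌉ = Q at hM hQ hmul
  lift Q to ℕ using hQ
  rcases hM.eq_or_lt with h | h
  · have : Q ^ 2 = Q * n + n ^ 2 + 1 := by zify; linarith
    obtain ⟨j, hj, hnj, -⟩ := exists_fib_of_norm_eq_one hn this
    exact Or.inr ⟨j, hj, hnj⟩
  · left
    have h2 : (2 : ℝ) ≤ ceilGap n * (ceilGap n + n * √5) := by
      rw [hmul]
      exact_mod_cast h
    have h0 := ceilGap_pos hn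
    have h1 := ceilGap_lt_one n
    have h5 := two_lt_sqrt_five
    have hkey : 1 ≤ n * ceilGap n * √5 := by nlinarith
    refine le_trans ?_ (mul_le_tan_ceilGap hn)
    calc π / (2 * √5) = π / (2 * √5) * 1 := by ring
      _ ≤ π / (2 * √5) * (n * ceilGap n * √5) := by gcongr
      _ = _ := by field_simp

theorem goldenConj_pow_even (j : ℕ) : goldenConj ^ (2 * j) = goldenRatio ^ (-(2 * (j : ℤ))) := by
  have h : goldenConj = -goldenRatio⁻¹ := by rw [inv_goldenRatio, neg_neg]
  rw [zpow_neg, h, (even_two_mul j).neg_pow, inv_pow]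
  norm_cast

theorem ceilGap_fib {j : ℕ} (hj : 1 ≤ j) :
    ceilGap (Nat.fib (2 * j)) = goldenRatio ^ (-(2 * (j : ℤ))) := by
  have h := fib_succ_sub_goldenRatio_mul_fib (2 * j)
  rw [goldenConj_pow_even] at h
  have hpos : 0 < goldenRatio ^ (-(2 * (j : ℤ))) := zpow_pos goldenRatio_pos _
  have hlt : goldenRatio ^ (-(2 * (j : ℤ))) < 1 :=
    zpow_lt_one_of_neg₀ one_lt_goldenRatio (by omega)
  have hceil : ⌈(Nat.fib (2 * j) : ℝ) * goldenRatio⌉ = (Nat.fib (2 * j + 1) : ℤ) :=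
    Int.ceil_eq_iff.2 ⟨by push_cast; linarith, by push_cast; linarith⟩
  rw [ceilGap, hceil, ← h]
  push_cast
  ring

theorem goldenThreshold_eq (a : ℝ) {j : ℕ} (hj : 1 ≤ j) : goldenThreshold a j =
    2 * π / a * (Nat.fib (2 * j) * Real.tan (π / 2 * ceilGap (Nat.fib (2 * j)))) := by
  rw [ceilGap_fib hj, Real.coe_fib_eq, goldenConj_pow_even, goldenThreshold]
  have : goldenRatio ^ (2 * j) = goldenRatio ^ (2 * (j : ℤ)) := by norm_cast
  rw [this]
  field_simp

theorem strictAntiOn_inv_sub_mul_tan :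
    StrictAntiOn (fun t : ℝ => (t⁻¹ - t) * Real.tan (π / 2 * t)) (Set.Ioc 0 (2 / 5)) := by
  have hpi := Real.pi_pos
  have hpi4 := Real.pi_lt_d2
  have hcos : ∀ t ∈ Set.Ioc (0 : ℝ) (2 / 5), 0 < Real.cos (π / 2 * t) := fun t ht =>
    Real.cos_pos_of_mem_Ioo ⟨by nlinarith [ht.1], by nlinarith [ht.2]⟩
  have hderiv : ∀ t ∈ Set.Ioc (0 : ℝ) (2 / 5),
      HasDerivAt (fun t : ℝ => (t⁻¹ - t) * Real.tan (π / 2 * t))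
      ((-(t ^ 2)⁻¹ - 1) * Real.tan (π / 2 * t) +
        (t⁻¹ - t) * (1 / Real.cos (π / 2 * t) ^ 2 * (π / 2 * 1))) t := fun t ht =>
    ((hasDerivAt_inv ht.1.ne').sub (hasDerivAt_id t)).mul
      ((Real.hasDerivAt_tan (hcos t ht).ne').comp t ((hasDerivAt_id t).const_mul (π / 2)))
  refine strictAntiOn_of_deriv_neg (convex_Ioc _ _)
    (fun t ht => (hderiv t ht).continuousAt.continuousWithinAt) fun t ht => ?_
  have ht' := interior_subset ht
  have ht0 := ht'.1
  rw [(hderiv t ht').deriv]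
  have hc := hcos t ht'
  have hval : (-(t ^ 2)⁻¹ - 1) * Real.tan (π / 2 * t) +
      (t⁻¹ - t) * (1 / Real.cos (π / 2 * t) ^ 2 * (π / 2 * 1)) =
      (π * t * (1 - t ^ 2) - (1 + t ^ 2) * Real.sin (π * t)) /
        (2 * t ^ 2 * Real.cos (π / 2 * t) ^ 2) := by
    rw [show π * t = 2 * (π / 2 * t) by ring, Real.sin_two_mul, Real.tan_eq_sin_div_cos]
    field_simp
    ring
  rw [hval]
  refine div_neg_of_neg_of_pos ?_ (by positivity)
  have hsin := Real.sin_gt_sub_cube (x := π * t) (by positivity)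
  have ht2 : t ^ 2 ≤ 4 / 25 := by nlinarith [ht'.2]
  have hpi2 : π ^ 2 ≤ 9.9225 := by nlinarith
  have hfac : 0 ≤ π * t ^ 3 * (12 - π ^ 2 * (1 + t ^ 2)) := by
    have : π ^ 2 * (1 + t ^ 2) ≤ 9.9225 * (29 / 25) := by gcongr; linarith
    have : 0 ≤ 12 - π ^ 2 * (1 + t ^ 2) := by linarith
    positivity
  have h1 : (1 + t ^ 2) * (π * t - (π * t) ^ 3 / 6) < (1 + t ^ 2) * Real.sin (π * t) := by
    gcongr
  nlinarith

theorem tendsto_inv_sub_mul_tan :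
    Filter.Tendsto (fun t : ℝ => (t⁻¹ - t) * Real.tan (π / 2 * t)) (nhdsWithin 0 (Set.Ioi 0))
      (nhds (π / 2)) := by
  have hd : HasDerivAt (fun t : ℝ => Real.tan (π / 2 * t)) (π / 2) 0 := by
    have h0 : Real.cos (π / 2 * 0) ≠ 0 := by simp
    have h : HasDerivAt (fun t : ℝ => Real.tan (π / 2 * t))
        (1 / Real.cos (π / 2 * 0) ^ 2 * (π / 2 * 1)) 0 :=
      (Real.hasDerivAt_tan h0).comp (0 : ℝ) ((hasDerivAt_id (0 : ℝ)).const_mul (π / 2))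
    simpa using h
  have h1 := hd.tendsto_slope_zero_right
  have h2 : Filter.Tendsto (fun t : ℝ => t * Real.tan (π / 2 * t)) (nhdsWithin 0 (Set.Ioi 0))
      (nhds (0 * Real.tan (π / 2 * 0))) :=
    (continuousAt_id.mul hd.continuousAt).tendsto.mono_left nhdsWithin_le_nhds
  have h3 := h1.sub h2
  simp only [zero_add, mul_zero, Real.tan_zero, sub_zero, smul_eq_mul] at h3
  exact h3.congr fun t => by ring

theorem inv_sub_mul_tan_lt {t : ℝ} (ht : t ∈ Set.Ioc (0 : ℝ) (2 / 5)) :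
    (t⁻¹ - t) * Real.tan (π / 2 * t) < π / 2 := by
  have hmid : t / 2 ∈ Set.Ioc (0 : ℝ) (2 / 5) := ⟨by linarith [ht.1], by linarith [ht.1, ht.2]⟩
  have h := strictAntiOn_inv_sub_mul_tan hmid ht (by linarith [ht.1])
  refine h.trans_le (ge_of_tendsto tendsto_inv_sub_mul_tan ?_)
  filter_upwards [Ioo_mem_nhdsGT hmid.1] with s hs
  exact (strictAntiOn_inv_sub_mul_tan ⟨hs.1, hs.2.le.trans hmid.2⟩ hmid hs.2).le

theorem goldenThreshold_eq_inv_sub (a : ℝ) (j : ℕ) : goldenThreshold a j =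
    2 * π / (√5 * a) * (((goldenRatio ^ (-(2 * (j : ℤ))))⁻¹ - goldenRatio ^ (-(2 * (j : ℤ)))) *
      Real.tan (π / 2 * goldenRatio ^ (-(2 * (j : ℤ))))) := by
  rw [goldenThreshold, mul_assoc, ← zpow_neg, neg_neg]

theorem goldenRatio_zpow_mem {j : ℕ} (hj : 1 ≤ j) :
    goldenRatio ^ (-(2 * (j : ℤ))) ∈ Set.Ioc (0 : ℝ) (2 / 5) := by
  refine ⟨zpow_pos goldenRatio_pos _, ?_⟩
  have h1 : goldenRatio ^ (-(2 * (j : ℤ))) ≤ goldenRatio ^ (-2 : ℤ) :=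
    zpow_le_zpow_right₀ one_lt_goldenRatio.le (by omega)
  refine h1.trans ?_
  rw [zpow_neg, inv_le_comm₀ (zpow_pos goldenRatio_pos _) (by norm_num)]
  have : goldenRatio ^ (2 : ℤ) = goldenRatio + 1 := by
    rw [← goldenRatio_sq]
    norm_cast
  rw [this]
  simp only [goldenRatio]
  linarith [two_lt_sqrt_five]

theorem goldenThreshold_lt_goldenThreshold {a : ℝ} (ha : 0 < a) {i j : ℕ} (hi : 1 ≤ i)
    (hij : i < j) : goldenThreshold a i < goldenThreshold a j := by
  rw [goldenThreshold_eq_inv_sub, goldenThreshold_eq_inv_sub]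
  refine mul_lt_mul_of_pos_left ?_ (by positivity)
  exact strictAntiOn_inv_sub_mul_tan (goldenRatio_zpow_mem (hi.trans hij.le))
    (goldenRatio_zpow_mem hi) (zpow_lt_zpow_right₀ one_lt_goldenRatio (by omega))

theorem goldenThreshold_lt {a : ℝ} (ha : 0 < a) {j : ℕ} (hj : 1 ≤ j) :
    goldenThreshold a j < 2 * π / a * (π / (2 * √5)) := by
  rw [goldenThreshold_eq_inv_sub]
  calc _ < 2 * π / (√5 * a) * (π / 2) := by
        gcongr
        exact inv_sub_mul_tan_lt (goldenRatio_zpow_mem hj)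
    _ = _ := by field_simp

theorem cot_pi_div_two_sub (x : ℝ) : Real.cot (π / 2 - x) = Real.tan x := by
  rw [Real.cot_eq_cos_div_sin, Real.cos_pi_div_two_sub, Real.sin_pi_div_two_sub,
    Real.tan_eq_sin_div_cos]

theorem leftLevel_left {a b : ℝ} (hb : 0 < b) (hab : a = goldenRatio * b) (n : ℕ) :
    leftLevel a b (n * π / a) = 2 * π / a * (n * Real.tan (π / 2 * ceilGap n)) := by
  have hφ := goldenRatio_pos
  have hsq := goldenRatio_sq
  have ha : 0 < a := by rw [hab]; positivity
  have e1 : n * π / a * a = n * π := by field_simp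
  have hdiv : 1 / goldenRatio = goldenRatio - 1 := by
    rw [div_eq_iff hφ.ne']
    linear_combination -hsq
  have e2 : n * π / a * b = (n * goldenRatio - n) * π := by
    calc n * π / a * b = n * π * (1 / goldenRatio) := by rw [hab]; field_simp
      _ = _ := by rw [hdiv]; ring
  have c1 : ⌈(n : ℝ) * π / π⌉ = n := by
    rw [mul_div_cancel_right₀ _ Real.pi_ne_zero, Int.ceil_natCast]
  have c2 : ⌈(n * goldenRatio - n) * π / π⌉ = ⌈(n : ℝ) * goldenRatio⌉ - n := by
    rw [mul_div_cancel_right₀ _ Real.pi_ne_zero, Int.ceil_sub_natCast]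
  rw [leftLevel, cellFun, e1, e2, c1, c2]
  have t1 : n * π / 2 - π / 2 * ((n - 1 : ℤ) : ℝ) = π / 2 - 0 := by push_cast; ring
  have t2 : (n * goldenRatio - n) * π / 2 - π / 2 * ((⌈(n : ℝ) * goldenRatio⌉ - n - 1 : ℤ) : ℝ)
      = π / 2 - π / 2 * ceilGap n := by
    rw [ceilGap]
    push_cast
    ring
  rw [t1, t2, cot_pi_div_two_sub, cot_pi_div_two_sub, Real.tan_zero]
  ring

theorem leftLevel_right {a b : ℝ} (hb : 0 < b) (hab : a = goldenRatio * b) (n : ℕ) :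
    leftLevel a b (n * π / b) =
      2 * π / a * (goldenRatio * (n * Real.tan (π / 2 * ceilGap n))) := by
  have hφ := goldenRatio_pos
  have e1 : n * π / b * b = n * π := by field_simp
  have e2 : n * π / b * a = (n * goldenRatio) * π := by rw [hab]; field_simp
  have c1 : ⌈(n : ℝ) * π / π⌉ = n := by
    rw [mul_div_cancel_right₀ _ Real.pi_ne_zero, Int.ceil_natCast]
  have c2 : ⌈(n * goldenRatio) * π / π⌉ = ⌈(n : ℝ) * goldenRatio⌉ := by
    rw [mul_div_cancel_right₀ _ Real.pi_ne_zero]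
  rw [leftLevel, cellFun, e1, e2, c1, c2]
  have t1 : n * π / 2 - π / 2 * ((n - 1 : ℤ) : ℝ) = π / 2 - 0 := by push_cast; ring
  have t2 : (n * goldenRatio) * π / 2 - π / 2 * ((⌈(n : ℝ) * goldenRatio⌉ - 1 : ℤ) : ℝ)
      = π / 2 - π / 2 * ceilGap n := by
    rw [ceilGap]
    push_cast
    ring
  rw [t1, t2, cot_pi_div_two_sub, cot_pi_div_two_sub, Real.tan_zero, hab]
  field_simp
  ring

theorem image_fib_subset_gapEndpoints {a b : ℝ} (hb : 0 < b) (hab : a = goldenRatio * b) (α : ℝ) :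
    (fun j : ℕ => Nat.fib (2 * j) * π / a) '' {j | 1 ≤ j ∧ goldenThreshold a j < |α|} ⊆
      gapEndpoints a b α := by
  rintro _ ⟨j, ⟨hj, hlt⟩, rfl⟩
  have ha : 0 < a := by rw [hab]; have := goldenRatio_pos; positivity
  have hpi := Real.pi_pos
  have hfib : 0 < Nat.fib (2 * j) := Nat.fib_pos.2 (by omega)
  refine ⟨by positivity, Or.inl ⟨Nat.fib (2 * j), ?_⟩, ?_⟩
  · push_cast
    field_simp
  · rwa [leftLevel_left hb hab, ← goldenThreshold_eq a hj]

theorem gapEndpoints_subset_image_fib {a b α : ℝ} (hb : 0 < b) (hab : a = goldenRatio * b)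
    (hα : |α| ≤ 2 * π / a * (π / (2 * √5))) :
    gapEndpoints a b α ⊆
      (fun j : ℕ => Nat.fib (2 * j) * π / a) '' {j | 1 ≤ j ∧ goldenThreshold a j < |α|} := by
  have ha : 0 < a := by rw [hab]; have := goldenRatio_pos; positivity
  have hpi := Real.pi_pos
  have key : ∀ p c : ℝ, 0 < p → 0 < c → (∃ n : ℤ, p * c / π = n) →
      ∃ n : ℕ, 0 < n ∧ p = n * π / c := by
    rintro p c hp hc ⟨n, hn⟩
    have hn0 : (0 : ℝ) < n := by rw [← hn]; positivity
    have hn0 : 0 < n := by exact_mod_cast hn0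
    lift n to ℕ using hn0.le
    refine ⟨n, by exact_mod_cast hn0, ?_⟩
    rw [Int.cast_natCast] at hn
    rw [← hn]
    field_simp
  rintro p ⟨hp, hsing, hlt⟩
  rcases hsing with h | h
  · obtain ⟨n, hn, rfl⟩ := key p a hp ha h
    rw [leftLevel_left hb hab] at hlt
    rcases le_tan_ceilGap_or_exists_fib hn with h | ⟨j, hj, rfl⟩
    · have : 2 * π / a * (π / (2 * √5)) ≤ 2 * π / a * (n * Real.tan (π / 2 * ceilGap n)) := by
        gcongr
      exact absurd hlt (by linarith)
    · exact ⟨j, ⟨hj, by rwa [goldenThreshold_eq a hj]⟩, rfl⟩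
  · obtain ⟨n, hn, rfl⟩ := key p b hp hb h
    rw [leftLevel_right hb hab] at hlt
    have : 2 * π / a * (π / (2 * √5)) ≤
        2 * π / a * (goldenRatio * (n * Real.tan (π / 2 * ceilGap n))) := by
      gcongr
      exact le_goldenRatio_mul_tan_ceilGap hn
    exact absurd hlt (by linarith)

theorem injOn_fib_mul {a : ℝ} (ha : 0 < a) :
    Set.InjOn (fun j : ℕ => Nat.fib (2 * j) * π / a) {j | 1 ≤ j} := by
  intro i hi j hj h
  have hi : 1 ≤ i := hi
  have hj : 1 ≤ j := hj
  have hpi := Real.pi_ne_zero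
  have h1 : Nat.fib (2 * i) * π / a = Nat.fib (2 * j) * π / a := h
  rw [div_left_inj' ha.ne', mul_left_inj' hpi, Nat.cast_inj] at h1
  have := Nat.fib_strictMonoOn.injOn (show 2 * i ∈ Set.Ici 2 from by simp; omega)
    (show 2 * j ∈ Set.Ici 2 from by simp; omega) h1
  omega

/-- For the golden-mean rectangular lattice (`a/b = (1+√5)/2`) and
`α < 0`, there are exactly `N ≥ 1` gaps in the positive spectrum (the gap set has
exactly `N` connected components) if and only if `−A_{N+1} ≤ α < −A_N`. -/
theorem golden_mean_lattice_gap_count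
    (a b : ℝ) (ha : 0 < a) (hb : 0 < b) (hab : a / b = (1 + Real.sqrt 5) / 2)
    (N : ℕ) (hN : 1 ≤ N) (α : ℝ) (hα : α < 0) :
    ((gapComponents (gapSetMinus a b α)).Finite ∧
        (gapComponents (gapSetMinus a b α)).ncard = N) ↔
      (-(goldenThreshold a (N + 1)) ≤ α ∧ α < -(goldenThreshold a N)) := by
  have hab' : a = goldenRatio * b := (div_eq_iff hb.ne').1 hab
  obtain ⟨f, hf⟩ := exists_bijOn_gapComponents ha hb α
  rw [← hf.finite_iff_finite, ← hf.ncard_eq]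
  have habs : |α| = -α := abs_of_neg hα
  have hmono : ∀ {i j : ℕ}, 1 ≤ i → i ≤ j → goldenThreshold a i ≤ goldenThreshold a j :=
    fun hi hij => hij.eq_or_lt.elim (fun h => h ▸ le_rfl)
      fun h => (goldenThreshold_lt_goldenThreshold ha hi h).le
  have hcard : ∀ M : ℕ, ((fun j : ℕ => Nat.fib (2 * j) * π / a) '' Set.Icc 1 M).ncard = M := by
    intro M
    rw [((injOn_fib_mul ha).mono fun j hj => hj.1).ncard_image,
      ← Finset.coe_Icc, Set.ncard_coe_finset, Nat.card_Icc, Nat.add_sub_cancel]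
  have hfin : ∀ M : ℕ, ((fun j : ℕ => Nat.fib (2 * j) * π / a) '' Set.Icc 1 M).Finite :=
    fun M => (Set.finite_Icc 1 M).image _
  have hupper : ∀ M : ℕ, |α| ≤ goldenThreshold a (M + 1) → gapEndpoints a b α ⊆
      (fun j : ℕ => Nat.fib (2 * j) * π / a) '' Set.Icc 1 M := by
    intro M hM
    refine (gapEndpoints_subset_image_fib hb hab'
      (hM.trans (goldenThreshold_lt ha (by omega)).le)).trans (Set.image_mono ?_)
    rintro j ⟨hj, hlt⟩
    refine ⟨hj, ?_⟩
    by_contra! hcon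
    exact absurd (hlt.trans_le hM) (not_lt.2 (hmono (by omega) hcon))
  have hlower : ∀ M : ℕ, goldenThreshold a M < |α| →
      (fun j : ℕ => Nat.fib (2 * j) * π / a) '' Set.Icc 1 M ⊆ gapEndpoints a b α := by
    rintro M hM _ ⟨j, hj, rfl⟩
    exact image_fib_subset_gapEndpoints hb hab' α
      ⟨j, ⟨hj.1, (hmono hj.1 hj.2).trans_lt hM⟩, rfl⟩
  constructor
  · rintro ⟨hfinite, hN'⟩
    constructor
    · by_contra! hcon
      have := Set.ncard_le_ncard (hlower (N + 1) (by linarith)) hfinite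
      rw [hcard] at this
      omega
    · by_contra! hcon
      obtain ⟨M, rfl⟩ := Nat.exists_eq_add_of_le' hN
      have := Set.ncard_le_ncard (hupper M (by linarith)) (hfin M)
      rw [hcard] at this
      omega
  · rintro ⟨h1, h2⟩
    rw [(hupper N (by linarith)).antisymm (hlower N (by linarith))]
    exact ⟨hfin N, hcard N⟩
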